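/- arXiv:1910.00931 — 2 statements merged into one kernel-verified Lean document; each statement's English description precedes it below -/
import Mathlib

section
/- For every function f : ℕ+ → ℕ+, the group 𝒫(f) is trivial if and only if every forward orbit of f is eventually periodic of period at most 3. -/
/-- The relators of the presentation `𝒫(f)`: for each `i ∈ ℕ+`, the word
`a_{f(i)}⁻¹ a_i a_{f(i)} a_i⁻²` in the free group on `ℕ+`. -/
def Prels (f : ℕ+ → ℕ+) : Set (FreeGroup ℕ+) :=
  {r | ∃ i : ℕ+, r =
    (FreeGroup.of (f i))⁻¹ * FreeGroup.of i * FreeGroup.of (f i) * (FreeGroup.of i ^ 2)⁻¹}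

/-- The forward orbit of `i` under `f` is eventually periodic of period at most 3. -/
def EventuallyPeriodicPeriodLE3 (f : ℕ+ → ℕ+) (i : ℕ+) : Prop :=
  ∃ N p : ℕ, 1 ≤ p ∧ p ≤ 3 ∧ ∀ n ≥ N, f^[n + p] i = f^[n] i

section HigmanCycles

variable {G : Type*} [Group G]

/-- The relation `y⁻¹ * x * y = x ^ 2`. -/
def ConjSq (x y : G) : Prop := y⁻¹ * x * y = x ^ 2

theorem ConjSq.mul_eq {x y : G} (h : ConjSq x y) : x * y = y * x ^ 2 := by
  rw [← h]; group

theorem conjSq_of_mul_eq {x y : G} (h : x * y = y * x ^ 2) : ConjSq x y := by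
  rw [ConjSq, mul_assoc, h, inv_mul_cancel_left]

theorem ConjSq.pow_mul_eq {x y : G} (h : ConjSq x y) (k : ℕ) : x ^ k * y = y * x ^ (2 * k) := by
  have : SemiconjBy y (x ^ 2) x := h.mul_eq.symm
  rw [pow_mul]
  exact (this.pow_right k).symm

theorem ConjSq.eq_one_of_commute {x y : G} (h : ConjSq x y) (hc : Commute x y) : x = 1 := by
  have h' := h.mul_eq
  rw [hc.eq, pow_two] at h'
  simpa using h'

theorem ConjSq.eq_one_of_right_eq_one {x y : G} (h : ConjSq x y) (hy : y = 1) : x = 1 :=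
  h.eq_one_of_commute (hy ▸ Commute.one_right x)

theorem ConjSq.one_left (y : G) : ConjSq 1 y := by
  simp [ConjSq]

theorem ConjSq.map {H : Type*} [Group H] {x y : G} (h : ConjSq x y) (ψ : G →* H) :
    ConjSq (ψ x) (ψ y) := by
  simpa [ConjSq] using congrArg ψ h

theorem eq_one_of_conjSq_two_cycle {a b : G} (hab : ConjSq a b) (hba : ConjSq b a) : a = 1 := by
  have h : a = b⁻¹ := by
    calc a = a⁻¹ * a ^ 2 := by simp [pow_two]
      _ = a⁻¹ * (b⁻¹ * a * b) := by rw [hab]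
      _ = (a⁻¹ * b * a)⁻¹ * b := by group
      _ = b⁻¹ := by rw [hba]; simp [pow_two]
  exact hab.eq_one_of_commute (h ▸ (Commute.refl b).inv_left)

theorem eq_one_of_conjSq_three_cycle {a b c : G} (hab : ConjSq a b) (hbc : ConjSq b c)
    (hca : ConjSq c a) : a = 1 := by
  have hac (k : ℕ) : a⁻¹ * c ^ k = c ^ (2 * k) * a⁻¹ := by
    rw [inv_mul_eq_iff_eq_mul, ← mul_assoc, ← hca.pow_mul_eq, mul_inv_cancel_right]
  have hb2 (k : ℕ) : b ^ k * c ^ 2 = c ^ 2 * b ^ (4 * k) := by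
    rw [pow_two, ← mul_assoc, hbc.pow_mul_eq, mul_assoc, hbc.pow_mul_eq, ← mul_assoc]
    ring_nf
  have hconj : a⁻¹ * b * a = b * a⁻¹ := by
    rw [mul_assoc, inv_mul_eq_iff_eq_mul, ← mul_assoc, hab.mul_eq]; group
  have h₁ : b * a⁻¹ * c ^ 2 = c ^ 2 * (b * a⁻¹ * (b * a⁻¹)) := by
    have hac' : a⁻¹ * c * a = c ^ 2 := hca
    rw [← hconj, ← hac']
    calc a⁻¹ * b * a * (a⁻¹ * c * a) = a⁻¹ * (b * c) * a := by group
      _ = a⁻¹ * (c * b ^ 2) * a := by rw [hbc.mul_eq]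
      _ = _ := by rw [pow_two]; group
  have h₂ : b ^ 4 * c ^ 2 = b * a⁻¹ * b := by
    rw [mul_assoc b, hac, show 2 * 2 = 2 + 2 from rfl, pow_add, ← mul_assoc, ← mul_assoc,
      ← pow_one b, hb2 1, pow_one] at h₁
    exact mul_right_cancel (b := a⁻¹) (by simpa [mul_assoc] using h₁)
  have h₃ : a⁻¹ = c ^ 2 * b ^ 11 := by
    have h : b ^ 3 * c ^ 2 = a⁻¹ * b := by
      apply mul_left_cancel (a := b)
      rw [← mul_assoc, ← pow_succ', h₂, mul_assoc]
    rw [hb2] at h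
    rw [eq_comm, ← mul_inv_eq_iff_eq_mul.mpr h]
    group
  have h₄ : c = b ^ 11 := by
    have h := hac 1
    rw [h₃, pow_one, mul_assoc, hbc.pow_mul_eq, mul_one, mul_right_inj, pow_two c, mul_assoc,
      mul_right_inj, two_mul, pow_add, mul_left_inj] at h
    exact h.symm
  have hb : b = 1 := hbc.eq_one_of_commute (h₄ ▸ (Commute.refl b).pow_right 11)
  exact hab.eq_one_of_right_eq_one hb

end HigmanCycles

section Britton

open HNNExtension

theorem HNNExtension.lift_comp_injective {H G : Type*} [Group H] [Group G] {A B : Subgroup G}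
    {φ : A ≃* B} (ι : H →* G) (hι : Function.Injective ι) (hA : ∀ h, ι h ∈ A → h = 1)
    (hB : ∀ h, ι h ∈ B → h = 1) (ψ : HNNExtension H ⊥ ⊥ (MulEquiv.refl _) →* HNNExtension G A B φ)
    (hof : ∀ h, ψ (of h) = of (ι h)) (ht : ψ t = t) : Function.Injective ψ := by
  rw [injective_iff_map_eq_one]
  intro g hg
  obtain ⟨d⟩ := NormalWord.TransversalPair.nonempty H (⊥ : Subgroup H) ⊥
  obtain ⟨w, rfl⟩ := (NormalWord.equiv (MulEquiv.refl _) d).symm.surjective g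
  change ψ (w.toReducedWord.prod (MulEquiv.refl _)) = 1 at hg
  change w.toReducedWord.prod (MulEquiv.refl _) = 1
  generalize w.toReducedWord = w at hg
  let w' : NormalWord.ReducedWord G A B :=
    { head := ι w.head
      toList := w.toList.map (Prod.map id ι)
      chain := by
        rw [List.isChain_map]
        refine w.chain.imp fun a b hab h => hab ?_
        have : a.2 = 1 := by
          rcases Int.units_eq_one_or a.1 with h1 | h1
          · exact hA _ (by simpa [h1] using h)
          · exact hB _ (by simpa [h1] using h)
        rw [this]; exact one_mem _ }
  have hw' : w'.prod φ = ψ (w.prod (MulEquiv.refl _)) := by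
    simp [w', NormalWord.ReducedWord.prod, map_list_prod, hof, ht, Function.comp_def]
  have hnil : w.toList = [] := by
    simpa [w'] using ReducedWord.toList_eq_nil_of_mem_of_range φ w' (hw' ▸ hg ▸ one_mem _)
  have hhead : w.head = 1 := by
    apply hι
    apply of_injective (φ := φ)
    simpa [NormalWord.ReducedWord.prod, hnil, hof] using hg
  simp [NormalWord.ReducedWord.prod, hnil, hhead]

end Britton

section Chain

/-- The bijection of `ℤ × ℕ` given by `(n, m) ↦ (n / 2, 2 * m + n % 2)`. -/
def halve : Equiv.Perm (ℤ × ℕ) where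
  toFun x := (x.1 / 2, 2 * x.2 + (x.1 % 2).toNat)
  invFun x := (2 * x.1 + (x.2 % 2 : ℕ), x.2 / 2)
  left_inv := fun ⟨n, m⟩ => by ext <;> simp <;> omega
  right_inv := fun ⟨n, m⟩ => by ext <;> simp <;> omega

/-- Translation of the first coordinate of `(ℤ × ℕ) × ℤ`. -/
def shift : Equiv.Perm ((ℤ × ℕ) × ℤ) where
  toFun x := ((x.1.1 + 1, x.1.2), x.2)
  invFun x := ((x.1.1 - 1, x.1.2), x.2)
  left_inv := fun ⟨⟨n, m⟩, k⟩ => by simp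
  right_inv := fun ⟨⟨n, m⟩, k⟩ => by simp

/-- A fixed-point-free permutation conjugating `shift` to its square. -/
def dilate : Equiv.Perm ((ℤ × ℕ) × ℤ) where
  toFun x := (halve x.1, x.2 + 1)
  invFun x := (halve⁻¹ x.1, x.2 - 1)
  left_inv := fun ⟨x, k⟩ => by simp
  right_inv := fun ⟨x, k⟩ => by simp

/-- A permutation conjugating `shift` to `dilate`. -/
def straighten : Equiv.Perm ((ℤ × ℕ) × ℤ) where
  toFun x := ((halve ^ x.1.1) (x.2, x.1.2), x.1.1)
  invFun x := ((x.2, ((halve ^ (-x.2)) x.1).2), ((halve ^ (-x.2)) x.1).1)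
  left_inv := fun ⟨⟨n, m⟩, k⟩ => by simp
  right_inv := fun ⟨x, k⟩ => by simp

theorem conjSq_shift_dilate : ConjSq shift dilate := by
  apply conjSq_of_mul_eq
  ext ⟨⟨n, m⟩, k⟩ <;> simp [shift, dilate, halve, pow_two] <;> omega

theorem straighten_conj_shift : straighten * shift * straighten⁻¹ = dilate := by
  rw [mul_inv_eq_iff_eq_mul]
  ext1 ⟨⟨n, m⟩, k⟩
  simp [shift, dilate, straighten, add_comm n 1, zpow_add]

theorem shift_zpow_apply (k : ℤ) (x : (ℤ × ℕ) × ℤ) :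
    ((shift ^ k) x).1.1 = x.1.1 + k := by
  induction k with
  | zero => simp
  | succ k ih =>
    rw [add_comm (k : ℤ) 1, zpow_add, Equiv.Perm.mul_apply, zpow_one, shift, Equiv.coe_fn_mk]
    change ((shift ^ (k : ℤ)) x).1.1 + 1 = _
    rw [ih]; ring
  | pred k ih =>
    rw [sub_eq_add_neg, add_comm (-k : ℤ) (-1), zpow_add, Equiv.Perm.mul_apply, zpow_neg_one]
    change ((shift ^ (-k : ℤ)) x).1.1 - 1 = _
    rw [ih]; ring

theorem exists_conjSq_chain : ∃ a : ℕ → Equiv.Perm ((ℤ × ℕ) × ℤ),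
    (∀ i, ConjSq (a i) (a (i + 1))) ∧ ∀ i (k : ℤ), a i ^ k = 1 → k = 0 := by
  refine ⟨fun i => MulAut.conj (straighten ^ i) shift, fun i => ?_, fun i k hk => ?_⟩
  · have : MulAut.conj (straighten ^ (i + 1)) shift =
        MulAut.conj (straighten ^ i) dilate := by
      rw [pow_succ, map_mul, MulAut.mul_apply, MulAut.conj_apply straighten,
        straighten_conj_shift]
    beta_reduce
    rw [this]
    exact conjSq_shift_dilate.map (MulAut.conj (straighten ^ i)).toMonoidHom
  · rw [← map_zpow, EmbeddingLike.map_eq_one_iff] at hk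
    simpa [hk] using (shift_zpow_apply k ((0, 0), 0)).symm

theorem exists_conjSq_segment (m : ℕ) (hm : 1 ≤ m) :
    ∃ (G : Type) (_ : Group G) (b : ℕ → G), (∀ i < m, ConjSq (b i) (b (i + 1))) ∧
      (∀ k : ℤ, b 0 ^ k = 1 → k = 0) ∧ (∀ k : ℤ, b m ^ k = 1 → k = 0) ∧
      ∀ j k : ℤ, b 0 ^ j = b m ^ k → j = 0 := by
  obtain ⟨a, ha, hord⟩ := exists_conjSq_chain
  refine ⟨Equiv.Perm ((ℤ × ℕ) × ℤ) × Multiplicative ℤ, inferInstance,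
    fun i => (a i, if i = m then .ofAdd 1 else 1), fun i hi => ?_,
    fun k hk => hord 0 k (congrArg Prod.fst hk), fun k hk => hord m k (congrArg Prod.fst hk),
    fun j k h => ?_⟩
  · ext1
    · exact ha i
    · simp only [hi.ne, if_false]
      exact ConjSq.one_left (G := Multiplicative ℤ) _
  · have h2 := congrArg Prod.snd h
    have hk : k = 0 := by
      have : (1 : Multiplicative ℤ) = .ofAdd k := by
        simpa [show 0 ≠ m by omega, ← ofAdd_zsmul] using h2
      exact (Multiplicative.ofAdd.injective this).symm
    subst hk
    exact hord 0 j (by simpa using congrArg Prod.fst h)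

end Chain

section Cycle

open HNNExtension

/-- The free product of two infinite cyclic groups, with free generators
`of (.ofAdd 1)` and `t`. -/
abbrev FreeTwo : Type :=
  HNNExtension (Multiplicative ℤ) ⊥ ⊥ (MulEquiv.refl (⊥ : Subgroup (Multiplicative ℤ)))

theorem FreeTwo.hom_ext {G : Type*} [Group G] {ψ χ : FreeTwo →* G}
    (hof : ψ (of (.ofAdd 1)) = χ (of (.ofAdd 1))) (ht : ψ t = χ t) : ψ = χ :=
  HNNExtension.hom_ext (MonoidHom.ext_mint hof) ht

/-- The homomorphism from `FreeTwo` with prescribed values on the generators. -/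
def FreeTwo.lift {G : Type*} [Group G] (x y : G) : FreeTwo →* G :=
  HNNExtension.lift (zpowersHom G x) y (by
    rintro ⟨a, ha⟩
    obtain rfl := Subgroup.mem_bot.mp ha
    simp)

@[simp]
theorem FreeTwo.lift_of {G : Type*} [Group G] (x y : G) (k : Multiplicative ℤ) :
    FreeTwo.lift x y (of k) = zpowersHom G x k :=
  HNNExtension.lift_of ..

@[simp]
theorem FreeTwo.lift_t {G : Type*} [Group G] (x y : G) : FreeTwo.lift x y t = y :=
  HNNExtension.lift_t ..

theorem zpowersHom_injective {G : Type*} [Group G] {x : G} (hx : ∀ k : ℤ, x ^ k = 1 → k = 0) :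
    Function.Injective (zpowersHom G x) := by
  rw [injective_iff_map_eq_one]
  exact fun k hk => hx k.toAdd hk

theorem exists_conjSq_segment_free (m : ℕ) :
    ∃ (G : Type) (_ : Group G) (d : ℕ → G), (∀ i < m + 2, ConjSq (d i) (d (i + 1))) ∧
      Function.Injective (FreeTwo.lift (d 0) (d (m + 2))) := by
  obtain ⟨G, _, b, hb, h0, hm, hdisj⟩ := exists_conjSq_segment (m + 1) (by omega)
  set x := b (m + 1)
  have hx2 : ∀ k : ℤ, (x ^ 2) ^ k = 1 → k = 0 := fun k hk => by
    have := hm (2 * k) (by rw [zpow_mul]; exact_mod_cast hk)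
    omega
  let φ := (MonoidHom.ofInjective (zpowersHom_injective hx2)).symm.trans
    (MonoidHom.ofInjective (zpowersHom_injective hm))
  have hφ : (φ (MonoidHom.ofInjective (zpowersHom_injective hx2) (.ofAdd 1)) : G) = x := by
    simp only [φ, MulEquiv.trans_apply, MulEquiv.symm_apply_apply]
    simp [MonoidHom.ofInjective_apply]
  refine ⟨HNNExtension G _ _ φ, inferInstance, fun i => if i ≤ m + 1 then of (b i) else t,
    fun i hi => ?_, ?_⟩
  · rcases (Nat.lt_succ_iff.mp hi).lt_or_eq with h | rfl
    · simpa [h.le, Nat.succ_le_of_lt h] using (hb i h).map of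
    · have := t_mul_of (φ := φ) (MonoidHom.ofInjective (zpowersHom_injective hx2) (.ofAdd 1))
      rw [hφ] at this
      apply conjSq_of_mul_eq
      simpa [MonoidHom.ofInjective_apply] using this.symm
  · simp only [zero_le, if_true, show ¬ m + 2 ≤ m + 1 by omega, if_false]
    refine HNNExtension.lift_comp_injective (zpowersHom G (b 0)) (zpowersHom_injective h0)
      ?_ ?_ _ ?_ ?_
    · rintro h ⟨k, hk⟩
      refine hdisj h.toAdd (2 * k.toAdd) (hk.symm.trans ?_)
      rw [zpowersHom_apply, zpow_mul, zpow_ofNat]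
    · rintro h ⟨k, hk⟩
      exact hdisj h.toAdd k.toAdd hk.symm
    · intro h
      simp [zpowersHom_apply]
    · simp

theorem FreeTwo.lift_swap_injective {G : Type*} [Group G] {x y : G}
    (h : Function.Injective (FreeTwo.lift x y)) : Function.Injective (FreeTwo.lift y x) := by
  have hinv : (FreeTwo.lift t (of (.ofAdd 1))).comp (FreeTwo.lift t (of (.ofAdd 1))) =
      MonoidHom.id FreeTwo := FreeTwo.hom_ext (by simp) (by simp)
  have hcomp : FreeTwo.lift y x = (FreeTwo.lift x y).comp (FreeTwo.lift t (of (.ofAdd 1))) :=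
    FreeTwo.hom_ext (by simp) (by simp)
  rw [hcomp]
  exact h.comp (Function.LeftInverse.injective (DFunLike.congr_fun hinv))

theorem exists_conjSq_cycle (n : ℕ) (hn : 4 ≤ n) :
    ∃ (G : Type) (_ : Group G) (c : ℕ → G), (∀ i, ConjSq (c i) (c (i + 1))) ∧
      (∀ i, c (i % n) = c i) ∧ c 0 ≠ 1 := by
  choose K inst d hd hinj using exists_conjSq_segment_free
  obtain ⟨p, rfl⟩ := Nat.exists_eq_add_of_le' hn
  let len : Bool → ℕ := fun s => cond s 0 p
  let φ : ∀ s : Bool, FreeTwo →* K (len s) := fun s =>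
    match s with
    | true => FreeTwo.lift (d 0 0) (d 0 2)
    | false => FreeTwo.lift (d p (p + 2)) (d p 0)
  have hφ : ∀ s, Function.Injective (φ s) := fun s =>
    match s with
    | true => hinj 0
    | false => FreeTwo.lift_swap_injective (hinj p)
  let ι₁ : K 0 →* Monoid.PushoutI φ := Monoid.PushoutI.of (φ := φ) true
  let ι₂ : K p →* Monoid.PushoutI φ := Monoid.PushoutI.of (φ := φ) false
  have hglue (g : FreeTwo) : ι₁ (FreeTwo.lift (d 0 0) (d 0 2) g) =
      ι₂ (FreeTwo.lift (d p (p + 2)) (d p 0) g) :=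
    (Monoid.PushoutI.of_apply_eq_base φ true g).trans
      (Monoid.PushoutI.of_apply_eq_base φ false g).symm
  have hstart : ι₁ (d 0 0) = ι₂ (d p (p + 2)) := by simpa using hglue (of (.ofAdd 1))
  have hend : ι₁ (d 0 2) = ι₂ (d p 0) := by simpa using hglue t
  let c₀ : ℕ → Monoid.PushoutI φ := fun r => if r < 2 then ι₁ (d 0 r) else ι₂ (d p (r - 2))
  have hc₀ : ∀ r < p + 4, ConjSq (c₀ r) (c₀ (r + 1)) := by
    intro r hr
    rcases lt_trichotomy r 1 with h | rfl | h
    · obtain rfl : r = 0 := by omega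
      simpa [c₀] using (hd 0 0 (by omega)).map ι₁
    · simpa [c₀, ← hend] using (hd 0 1 (by omega)).map ι₁
    · obtain ⟨q, rfl⟩ := Nat.exists_eq_add_of_le' h
      simpa [c₀] using (hd p q (by omega)).map ι₂
  have hwrap : c₀ (p + 4) = c₀ 0 := by simp [c₀, hstart]
  refine ⟨Monoid.PushoutI φ, inferInstance, fun i => c₀ (i % (p + 4)), fun i => ?_,
    fun i => by simp, ?_⟩
  · have hlt := Nat.mod_lt i (show 0 < p + 4 by omega)
    convert hc₀ _ hlt using 1
    beta_reduce
    rcases (Nat.succ_le_of_lt hlt).lt_or_eq with h | h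
    · rw [Nat.add_mod, Nat.mod_eq_of_lt (show 1 < p + 4 by omega), Nat.mod_eq_of_lt h]
    · rw [Nat.add_mod, Nat.mod_eq_of_lt (show 1 < p + 4 by omega)]
      rw [Nat.succ_eq_add_one] at h
      rw [h, Nat.mod_self, hwrap]
  · have hne : (of (.ofAdd 1) : FreeTwo) ≠ 1 := by
      rw [Ne, map_eq_one_iff _ (of_injective _)]
      decide
    have h1 : ι₁ (FreeTwo.lift (d 0 0) (d 0 2) (of (.ofAdd 1))) ≠ 1 := by
      rw [Ne, map_eq_one_iff ι₁ (Monoid.PushoutI.of_injective hφ true),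
        map_eq_one_iff _ (hinj 0)]
      exact hne
    simpa [c₀] using h1

end Cycle

section Presentation

theorem conjSq_presentedGroup_of (f : ℕ+ → ℕ+) (i : ℕ+) :
    ConjSq (PresentedGroup.of i : PresentedGroup (Prels f)) (PresentedGroup.of (f i)) := by
  have h : PresentedGroup.mk (Prels f) _ = 1 :=
    PresentedGroup.one_of_mem (rels := Prels f) ⟨i, rfl⟩
  simp only [map_mul, map_inv, map_pow] at h
  exact mul_inv_eq_one.mp h

theorem exists_ne_one_of_orbit_conjSq {G : Type*} [Group G] (f : ℕ+ → ℕ+) (x : ℕ+) (c : ℕ → G)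
    (hc : ∀ i, ConjSq (c i) (c (i + 1))) (hcx : ∀ k l, f^[k] x = f^[l] x → c k = c l)
    (h0 : c 0 ≠ 1) : ∃ g : PresentedGroup (Prels f), g ≠ 1 := by
  classical
  let v : ℕ+ → G := fun i => if h : ∃ k, f^[k] x = i then c h.choose else 1
  have hv (k : ℕ) : v (f^[k] x) = c k := by
    have h : ∃ l, f^[l] x = f^[k] x := ⟨k, rfl⟩
    simp only [v, dif_pos h]
    exact hcx _ _ h.choose_spec
  have hrel (i : ℕ+) : ConjSq (v i) (v (f i)) := by
    by_cases h : ∃ k, f^[k] x = i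
    · obtain ⟨k, rfl⟩ := h
      rw [← Function.iterate_succ_apply' f, hv, hv]
      exact hc k
    · simpa only [v, dif_neg h] using ConjSq.one_left _
  have hlift : ∀ r ∈ Prels f, FreeGroup.lift v r = 1 := by
    rintro r ⟨i, rfl⟩
    simpa [mul_inv_eq_one, ConjSq] using hrel i
  refine ⟨PresentedGroup.of x, fun h => h0 ?_⟩
  have := congrArg (PresentedGroup.toGroup hlift) h
  rw [PresentedGroup.toGroup.of, map_one] at this
  rw [← this]
  exact (hv 0).symm

theorem of_eq_one_of_iterate_eq_one {f : ℕ+ → ℕ+} (n : ℕ) (i : ℕ+)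
    (h : (PresentedGroup.of (f^[n] i) : PresentedGroup (Prels f)) = 1) :
    (PresentedGroup.of i : PresentedGroup (Prels f)) = 1 := by
  induction n generalizing i with
  | zero => exact h
  | succ n ih => exact (conjSq_presentedGroup_of f i).eq_one_of_right_eq_one (ih (f i) h)

theorem of_eq_one_of_isPeriodicPt {f : ℕ+ → ℕ+} {x : ℕ+} {p : ℕ} (hp : 1 ≤ p) (hp' : p ≤ 3)
    (hx : Function.IsPeriodicPt f p x) :
    (PresentedGroup.of x : PresentedGroup (Prels f)) = 1 := by
  have h₁ := conjSq_presentedGroup_of f x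
  have h₂ := conjSq_presentedGroup_of f (f x)
  have h₃ := conjSq_presentedGroup_of f (f (f x))
  interval_cases p
  · rw [show f x = x from hx] at h₁
    exact h₁.eq_one_of_commute (Commute.refl _)
  · rw [show f (f x) = x from hx] at h₂
    exact eq_one_of_conjSq_two_cycle h₁ h₂
  · rw [show f (f (f x)) = x from hx] at h₃
    exact eq_one_of_conjSq_three_cycle h₁ h₂ h₃

theorem exists_ne_one_of_not_eventuallyPeriodic {f : ℕ+ → ℕ+} {i : ℕ+}
    (h : ¬ EventuallyPeriodicPeriodLE3 f i) : ∃ g : PresentedGroup (Prels f), g ≠ 1 := by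
  by_cases hinj : Function.Injective fun n => f^[n] i
  · obtain ⟨a, ha, hord⟩ := exists_conjSq_chain
    refine exists_ne_one_of_orbit_conjSq f i a ha (fun k l hkl => congrArg a (hinj hkl)) ?_
    intro h0
    exact one_ne_zero (hord 0 1 (by simpa using h0))
  · obtain ⟨N, p, hp, hper⟩ : ∃ N p, 0 < p ∧ Function.IsPeriodicPt f p (f^[N] i) := by
      rw [Function.not_injective_iff] at hinj
      obtain ⟨k, l, hkl, hne⟩ := hinj
      wlog hlt : k < l generalizing k l
      · exact this l k hkl.symm hne.symm (by omega)
      refine ⟨k, l - k, by omega, ?_⟩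
      rw [Function.IsPeriodicPt, Function.IsFixedPt, ← Function.iterate_add_apply,
        Nat.sub_add_cancel hlt.le]
      exact hkl.symm
    set x := f^[N] i
    set n := Function.minimalPeriod f x
    have hpos : 0 < n := hper.minimalPeriod_pos hp
    have hn : 4 ≤ n := by
      by_contra! hlt
      refine h ⟨N, n, hpos, by omega, fun k hk => ?_⟩
      obtain ⟨q, rfl⟩ := Nat.exists_eq_add_of_le' hk
      rw [show q + N + n = (q + n) + N by omega, Function.iterate_add_apply _ _ N,
        Function.iterate_add_apply _ _ N, Function.iterate_add_apply,
        (Function.isPeriodicPt_minimalPeriod f x).eq]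
    obtain ⟨G, _, c, hc, hmod, h0⟩ := exists_conjSq_cycle n hn
    refine exists_ne_one_of_orbit_conjSq f x c hc (fun k l hkl => ?_) h0
    rw [← hmod k, ← hmod l]
    rw [← Function.iterate_mod_minimalPeriod_eq, ← Function.iterate_mod_minimalPeriod_eq (n := l),
      Function.iterate_eq_iterate_iff_of_lt_minimalPeriod (Nat.mod_lt _ hpos)
        (Nat.mod_lt _ hpos)] at hkl
    rw [hkl]

end Presentation

theorem stmt_0 (f : ℕ+ → ℕ+) :
    (∀ g : PresentedGroup (Prels f), g = 1) ↔
      ∀ i : ℕ+, EventuallyPeriodicPeriodLE3 f i := by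
  constructor
  · intro h i
    by_contra hi
    obtain ⟨g, hg⟩ := exists_ne_one_of_not_eventuallyPeriodic hi
    exact hg (h g)
  · intro h g
    have hid : MonoidHom.id (PresentedGroup (Prels f)) = 1 := by
      refine PresentedGroup.ext fun i => ?_
      obtain ⟨N, p, hp, hp', hN⟩ := h i
      refine of_eq_one_of_iterate_eq_one N i (of_eq_one_of_isPeriodicPt hp hp' ?_)
      rw [Function.IsPeriodicPt, Function.IsFixedPt, ← Function.iterate_add_apply, add_comm]
      exact hN N le_rfl
    exact DFunLike.congr_fun hid g
end

section
/- For every function f : ℕ+ → ℕ+ and every i ∈ ℕ+, the image of the generator a_i in the group 𝒫(f) is trivial if the forward orbit of i under f is eventually periodic of period at most 3, and has infinite order otherwise. -/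
open Function

section Triviality

variable {G : Type*} [Group G]

theorem conj_pow_of_doubling {a b : G} (h : b⁻¹ * a * b = a ^ 2) (n : ℕ) :
    b⁻¹ * a ^ n * b = a ^ (2 * n) := by
  have := conj_pow (a := b⁻¹) (b := a) (i := n)
  rw [inv_inv, h, ← pow_mul] at this
  exact this.symm

theorem pow_mul_of_doubling {a b : G} (h : b⁻¹ * a * b = a ^ 2) (n : ℕ) :
    a ^ n * b = b * a ^ (2 * n) := by
  rw [← conj_pow_of_doubling h]
  group

/-- In a doubling cycle of length three, the product of the squares is trivial. -/
theorem doubling_cycle_three_mul_sq {a b c : G} (hab : b⁻¹ * a * b = a ^ 2)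
    (hbc : c⁻¹ * b * c = b ^ 2) (hca : a⁻¹ * c * a = c ^ 2) : a ^ 2 * b ^ 2 * c ^ 2 = 1 := by
  have hac : c⁻¹ * a * c = a * c⁻¹ := by
    have h : c * a = a * c ^ 2 := by rw [← hca]; group
    calc c⁻¹ * a * c = c⁻¹ * (a * c ^ 2) * c⁻¹ := by group
      _ = a * c⁻¹ := by rw [← h]; group
  have hconj : (b ^ 2)⁻¹ * (a * c⁻¹) * b ^ 2 = (a * c⁻¹) ^ 2 := by
    rw [← hac, ← hbc]
    calc (c⁻¹ * b * c)⁻¹ * (c⁻¹ * a * c) * (c⁻¹ * b * c) = c⁻¹ * (b⁻¹ * a * b) * c := by group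
      _ = (c⁻¹ * a * c) ^ 2 := by rw [hab]; simp only [pow_two]; group
  have ha4 : (b ^ 2)⁻¹ * a * b ^ 2 = a ^ 4 := by
    calc (b ^ 2)⁻¹ * a * b ^ 2 = b⁻¹ * (b⁻¹ * a * b) * b := by simp only [pow_two]; group
      _ = a ^ 4 := by rw [hab, conj_pow_of_doubling hab]
  have hcb : (b ^ 2)⁻¹ * c⁻¹ * b ^ 2 = b ^ 2 * c⁻¹ := by
    have h : b * c = c * b ^ 2 := by simpa using pow_mul_of_doubling hbc 1
    calc (b ^ 2)⁻¹ * c⁻¹ * b ^ 2 = (c * b ^ 2)⁻¹ * b ^ 2 := by group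
      _ = c⁻¹ * b * c * c⁻¹ := by rw [← h]; group
      _ = b ^ 2 * c⁻¹ := by rw [hbc]
  have h1 : a ^ 4 * (b ^ 2 * c⁻¹) = a * c⁻¹ * (a * c⁻¹) := by
    rw [← ha4, ← hcb, ← pow_two, ← hconj]
    group
  have h2 : c⁻¹ * a = a * (c ^ 2)⁻¹ := by
    rw [← hca]
    group
  have h3 : a ^ 4 * (b ^ 2 * c⁻¹) = a * (a * (c ^ 2)⁻¹) * c⁻¹ := by
    rw [h1, ← h2]
    group
  calc a ^ 2 * b ^ 2 * c ^ 2 = a⁻¹ * a⁻¹ * (a ^ 4 * (b ^ 2 * c⁻¹)) * c * c ^ 2 := by group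
    _ = 1 := by rw [h3]; group

/-- In a doubling cycle of length three, the sixth powers of consecutive elements agree. -/
theorem doubling_cycle_three_pow_six {a b c : G} (hab : b⁻¹ * a * b = a ^ 2)
    (hbc : c⁻¹ * b * c = b ^ 2) (hca : a⁻¹ * c * a = c ^ 2) : b ^ 6 = c ^ 6 := by
  have h := doubling_cycle_three_mul_sq hab hbc hca
  have hb : b ^ 2 * c ^ 2 = c ^ 2 * b ^ 8 := by
    rw [pow_two c, ← mul_assoc, pow_mul_of_doubling hbc, mul_assoc, pow_mul_of_doubling hbc,
      mul_assoc]
  have hc : c ^ 2 * a ^ 2 = a ^ 2 * c ^ 8 := by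
    rw [pow_two a, ← mul_assoc, pow_mul_of_doubling hca, mul_assoc, pow_mul_of_doubling hca,
      mul_assoc]
  have ha : a ^ 2 = (b ^ 2 * c ^ 2)⁻¹ := eq_inv_of_mul_eq_one_left (by rw [← mul_assoc, h])
  have h1 : b ^ 2 * c ^ 2 = c ^ 8 * b ^ 2 := by
    rw [ha] at hc
    calc b ^ 2 * c ^ 2 = b ^ 2 * c ^ 2 * (c ^ 2 * (b ^ 2 * c ^ 2)⁻¹) * b ^ 2 := by group
      _ = c ^ 8 * b ^ 2 := by rw [hc]; group
  have h2 : c ^ 2 * b ^ 8 = c ^ 8 * b ^ 2 := hb.symm.trans h1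
  calc b ^ 6 = (c ^ 2)⁻¹ * (c ^ 2 * b ^ 8) * (b ^ 2)⁻¹ := by group
    _ = c ^ 6 := by rw [h2]; group

theorem doubling_cycle_three_pow_three {a b c : G} (hab : b⁻¹ * a * b = a ^ 2)
    (hbc : c⁻¹ * b * c = b ^ 2) (hca : a⁻¹ * c * a = c ^ 2) : b ^ 3 = 1 := by
  have h := doubling_cycle_three_pow_six hab hbc hca
  have h6 : b ^ 6 = 1 := by
    have h1 := conj_pow_of_doubling hbc 6
    rw [h, mul_assoc, pow_mul_comm', inv_mul_cancel_left, ← h,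
      show 2 * 6 = 6 + 6 from rfl, pow_add] at h1
    exact right_eq_mul.mp h1
  have h1 := conj_pow_of_doubling hbc 3
  rw [h6] at h1
  simpa [mul_assoc, inv_mul_eq_iff_eq_mul] using h1

theorem doubling_cycle_three {a b c : G} (hab : b⁻¹ * a * b = a ^ 2)
    (hbc : c⁻¹ * b * c = b ^ 2) (hca : a⁻¹ * c * a = c ^ 2) : a = 1 := by
  have hb := doubling_cycle_three_pow_three hab hbc hca
  have ha := doubling_cycle_three_pow_three hca hab hbc
  have h8 : a ^ 8 = a := by
    calc a ^ 8 = b⁻¹ * (b⁻¹ * (b⁻¹ * a * b) * b) * b := by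
          simp only [hab, conj_pow_of_doubling hab]
      _ = (b ^ 3)⁻¹ * a * b ^ 3 := by simp only [pow_succ, pow_zero]; group
      _ = a := by simp [hb]
  have h8' : a ^ 8 = a ^ 3 * a ^ 3 * a * a := by group
  rw [h8', ha] at h8
  simpa using h8

theorem doubling_cycle_two {a b : G} (hab : b⁻¹ * a * b = a ^ 2)
    (hba : a⁻¹ * b * a = b ^ 2) : a = 1 := by
  have h1 : a⁻¹ * b⁻¹ * a * b = a := by
    calc a⁻¹ * b⁻¹ * a * b = a⁻¹ * (b⁻¹ * a * b) := by group
      _ = a := by rw [hab]; group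
  have h2 : b⁻¹ * a⁻¹ * b * a = b := by
    calc b⁻¹ * a⁻¹ * b * a = b⁻¹ * (a⁻¹ * b * a) := by group
      _ = b := by rw [hba]; group
  have h3 : a * b = 1 := by
    conv_lhs => rw [← h1]
    conv_lhs => arg 2; rw [← h2]
    group
  obtain rfl := eq_inv_of_mul_eq_one_right h3
  simpa [pow_two] using hab

end Triviality

namespace Monoid

/-- Subgroups of the factors meeting the base trivially generate their free product
inside an amalgamated product. -/
theorem PushoutI.lift_of_comp_injective {ι H : Type*} {G K : ι → Type*} [∀ i, Group (G i)]
    [∀ i, Group (K i)] [Group H] {φ : ∀ i, H →* G i} (hφ : ∀ i, Injective (φ i))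
    (ψ : ∀ i, K i →* G i) (hψ : ∀ i k, ψ i k ∈ (φ i).range → k = 1) :
    Injective (CoprodI.lift fun i => (PushoutI.of (φ := φ) i).comp (ψ i)) := by
  classical
  rw [injective_iff_map_eq_one]
  intro g hg
  obtain ⟨w, rfl⟩ := CoprodI.Word.equiv.symm.surjective g
  change CoprodI.lift _ w.prod = 1 at hg
  change w.prod = 1
  let w' : CoprodI.Word G :=
    { toList := w.toList.map fun l => ⟨l.1, ψ l.1 l.2⟩
      ne_one := by
        intro l hl
        obtain ⟨l, hlw, rfl⟩ := List.mem_map.mp hl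
        intro h
        exact w.ne_one l hlw (hψ _ _ ⟨1, by simpa using h.symm⟩)
      chain_ne := by
        rw [List.isChain_map]
        exact w.chain_ne }
  have hw' : PushoutI.Reduced φ w' := by
    intro l hl
    obtain ⟨l, hlw, rfl⟩ := List.mem_map.mp hl
    exact fun h => w.ne_one l hlw (hψ _ _ h)
  have hprod : PushoutI.ofCoprodI (φ := φ) w'.prod = 1 := by
    rw [← hg]
    simp [CoprodI.Word.prod, w', map_list_prod, Function.comp_def]
  have he := hw'.eq_empty_of_mem_range hφ (hprod ▸ one_mem _)
  have hl : w'.toList = [] := by rw [he]; rfl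
  have hl : w.toList = [] := by simpa [w'] using hl
  simp [CoprodI.Word.prod, hl]

end Monoid

open Monoid

/-- The homomorphism from the free product `ℤ * ℤ` determined by two elements. -/
def pairHom {G : Type*} [Group G] (x y : G) :
    CoprodI (fun _ : Bool => Multiplicative ℤ) →* G :=
  CoprodI.lift fun i => zpowersHom G (bif i then x else y)

/-- Each of `x 0, …, x k` but the last is doubled under conjugation by its successor. -/
def IsDoublingChain {G : Type*} [Group G] (k : ℕ) (x : ℕ → G) : Prop :=
  ∀ j < k, (x (j + 1))⁻¹ * x j * x (j + 1) = x j ^ 2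

/-- `x` and `y` have infinite order and generate subgroups with trivial intersection. -/
def ZPowIndep {G : Type*} [Group G] (x y : G) : Prop :=
  ∀ m n : ℤ, x ^ m = y ^ n → m = 0 ∧ n = 0

section

variable {G : Type*} [Group G]

theorem ZPowIndep.symm {x y : G} (h : ZPowIndep x y) : ZPowIndep y x :=
  fun m n e => (h n m e.symm).symm

theorem ZPowIndep.zpowersHom_injective {x y : G} (h : ZPowIndep x y) :
    Injective (zpowersHom G x) := by
  rw [injective_iff_map_eq_one]
  intro m hm
  exact (h m.toAdd 0 (by simpa [zpowersHom_apply] using hm)).1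

theorem pairHom_swap_injective {x y : G} (h : Injective (pairHom x y)) :
    Injective (pairHom y x) := by
  let σ : CoprodI (fun _ : Bool => Multiplicative ℤ) →*
      CoprodI (fun _ : Bool => Multiplicative ℤ) :=
    CoprodI.lift fun i => CoprodI.of (M := fun _ : Bool => Multiplicative ℤ) (i := !i)
  have hσ : σ.comp σ = MonoidHom.id _ := by
    refine CoprodI.ext_hom _ _ fun i => ?_
    ext
    cases i <;> simp [σ]
  have hpair : pairHom y x = (pairHom x y).comp σ := by
    refine CoprodI.ext_hom _ _ fun i => ?_
    ext
    cases i <;> simp [σ, pairHom]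
  rw [hpair]
  exact h.comp (LeftInverse.injective (DFunLike.congr_fun hσ))

theorem zpowIndep_of_pairHom_injective {x y : G} (h : Injective (pairHom x y)) :
    ZPowIndep x y := by
  intro m n e
  have h1 : CoprodI.of (M := fun _ : Bool => Multiplicative ℤ) (i := true) (.ofAdd m) =
      CoprodI.of (M := fun _ : Bool => Multiplicative ℤ) (i := false) (.ofAdd n) :=
    h (by simpa [pairHom, zpowersHom_apply] using e)
  have h2 := congrArg (pairHom (Multiplicative.ofAdd (1 : ℤ)) 1) h1
  have h3 := congrArg (pairHom 1 (Multiplicative.ofAdd (1 : ℤ))) h1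
  simp only [pairHom, CoprodI.lift_of, zpowersHom_apply] at h2 h3
  simp [← ofAdd_zsmul] at h2 h3
  exact ⟨h2, h3.symm⟩

end

theorem exists_doubling_pair :
    ∃ (G : Type) (_ : Group G) (a t : G), t⁻¹ * a * t = a ^ 2 ∧ ZPowIndep a t := by
  let u : ℚˣ := Units.mk0 (1 / 2) (by norm_num)
  let T : ℚˣ →* Equiv.Perm ℚ := MulAction.toPermHom ℚˣ ℚ
  let S : Multiplicative ℚ →* Equiv.Perm ℚ := MulAction.toPermHom (Multiplicative ℚ) ℚ
  have hS (r q : ℚ) : S (.ofAdd r) q = r + q := rfl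
  have hT (v : ℚˣ) (q : ℚ) : T v q = v * q := rfl
  refine ⟨Equiv.Perm ℚ, inferInstance, S (.ofAdd 1), T u, ?_, ?_⟩
  · rw [mul_assoc, inv_mul_eq_iff_eq_mul]
    ext q
    simp only [Equiv.Perm.mul_apply, pow_two, hS, hT, u, Units.val_mk0]
    ring
  · intro m n h
    rw [← map_zpow S, ← map_zpow T, ← ofAdd_zsmul] at h
    have h0 := DFunLike.congr_fun h 0
    have hm : m = 0 := by simpa [hS, hT, -map_zpow] using h0
    refine ⟨hm, ?_⟩
    have h1 := DFunLike.congr_fun h 1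
    simp only [hS, hT, hm, u, zero_smul, zero_add, mul_one, Units.val_zpow_eq_zpow_val,
      Units.val_mk0] at h1
    exact (zpow_eq_one_iff_right₀ (by norm_num) (by norm_num)).mp h1.symm

theorem exists_chain_succ {G : Type} [Group G] {k : ℕ} {x : ℕ → G} (hx : IsDoublingChain k x)
    (hi : ZPowIndep (x 0) (x k)) :
    ∃ (P : Type) (_ : Group P) (y : ℕ → P), IsDoublingChain (k + 1) y ∧
      Injective (pairHom (y 0) (y (k + 1))) := by
  obtain ⟨B, _, a, t, hat, hBi⟩ := exists_doubling_pair
  let φ : Bool → Multiplicative ℤ →* B × G := fun i =>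
    bif i then (MonoidHom.inl B G).comp (zpowersHom B t)
    else (MonoidHom.inr B G).comp (zpowersHom G (x 0))
  have hφ : ∀ i, Injective (φ i) := by
    rintro (_ | _)
    · exact (Prod.mk_right_injective 1).comp hi.zpowersHom_injective
    · exact (Prod.mk_left_injective 1).comp hBi.symm.zpowersHom_injective
  let p : B →* PushoutI φ := (PushoutI.of true).comp (MonoidHom.inl B G)
  let q : G →* PushoutI φ := (PushoutI.of false).comp (MonoidHom.inr B G)
  have hpq : p t = q (x 0) := by
    have h := (PushoutI.of_apply_eq_base φ true (.ofAdd 1)).trans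
      (PushoutI.of_apply_eq_base φ false (.ofAdd 1)).symm
    simpa [φ, zpowersHom_apply, p, q] using h
  refine ⟨PushoutI φ, inferInstance, fun n => n.casesOn (p a) fun j => q (x j), ?_, ?_⟩
  · rintro (_ | j) hj
    · change (q (x 0))⁻¹ * p a * q (x 0) = p a ^ 2
      rw [← hpq, ← map_pow, ← hat]
      simp
    · change (q (x (j + 1)))⁻¹ * q (x j) * q (x (j + 1)) = q (x j) ^ 2
      rw [← map_pow, ← hx j (by omega)]
      simp
  · let ψ : Bool → Multiplicative ℤ →* B × G := fun i =>
      bif i then (MonoidHom.inl B G).comp (zpowersHom B a)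
      else (MonoidHom.inr B G).comp (zpowersHom G (x k))
    have h := PushoutI.lift_of_comp_injective hφ ψ (by
      rintro (_ | _) m ⟨n, hn⟩
      · simp [φ, ψ, zpowersHom_apply] at hn
        simpa using (hi _ _ hn).2
      · simp [φ, ψ, zpowersHom_apply] at hn
        simpa using (hBi _ _ hn.symm).1)
    convert h using 2
    unfold pairHom
    congr 1
    funext i
    ext
    cases i <;> simp [zpowersHom_apply, ψ, p, q]

theorem exists_free_chain (k : ℕ) :
    ∃ (G : Type) (_ : Group G) (x : ℕ → G), IsDoublingChain (k + 2) x ∧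
      Injective (pairHom (x 0) (x (k + 2))) := by
  induction k with
  | zero =>
    obtain ⟨B, _, a, t, hat, hi⟩ := exists_doubling_pair
    exact exists_chain_succ (x := fun n => if n = 0 then a else t) (k := 1)
      (by intro j hj; obtain rfl : j = 0 := by omega
          simpa using hat) (by simpa using hi)
  | succ k ih =>
    obtain ⟨G, _, x, hx, hi⟩ := ih
    exact exists_chain_succ hx (zpowIndep_of_pairHom_injective hi)

theorem exists_doubling_cycle {p : ℕ} (hp : 4 ≤ p) :
    ∃ (P : Type) (_ : Group P) (w : ℕ → P),
      (∀ n, (w (n + 1))⁻¹ * w n * w (n + 1) = w n ^ 2) ∧ (∀ m n, m ≡ n [MOD p] → w m = w n) ∧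
      ¬ IsOfFinOrder (w 0) := by
  obtain ⟨k, rfl⟩ := Nat.exists_eq_add_of_le' hp
  obtain ⟨G, _, x, hx, hxi⟩ := exists_free_chain 0
  obtain ⟨H, _, y, hy, hyi⟩ := exists_free_chain k
  have hy' : Injective (pairHom (y (k + 2)) (y 0)) := pairHom_swap_injective hyi
  let φ : Bool → CoprodI (fun _ : Bool => Multiplicative ℤ) →* G × H := fun i =>
    bif i then (MonoidHom.inl G H).comp (pairHom (x 0) (x 2))
    else (MonoidHom.inr G H).comp (pairHom (y (k + 2)) (y 0))
  have hφ : ∀ i, Injective (φ i) := by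
    rintro (_ | _)
    · exact (Prod.mk_right_injective 1).comp hy'
    · exact (Prod.mk_left_injective 1).comp hxi
  let q : G →* PushoutI φ := (PushoutI.of true).comp (MonoidHom.inl G H)
  let r : H →* PushoutI φ := (PushoutI.of false).comp (MonoidHom.inr G H)
  have hqr (u) : q (pairHom (x 0) (x 2) u) = r (pairHom (y (k + 2)) (y 0) u) :=
    (PushoutI.of_apply_eq_base φ true u).trans (PushoutI.of_apply_eq_base φ false u).symm
  have h0 : q (x 0) = r (y (k + 2)) := by
    simpa [pairHom, zpowersHom_apply] using hqr (CoprodI.of (i := true) (.ofAdd 1))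
  have h2 : q (x 2) = r (y 0) := by
    simpa [pairHom, zpowersHom_apply] using hqr (CoprodI.of (i := false) (.ofAdd 1))
  let z : ℕ → PushoutI φ := fun n => if n < 2 then q (x n) else r (y (n - 2))
  have hz : IsDoublingChain (k + 4) z := by
    intro j hj
    have hq (j) (hj : j < 2) : (q (x (j + 1)))⁻¹ * q (x j) * q (x (j + 1)) = q (x j) ^ 2 := by
      rw [← map_pow, ← hx j hj]
      simp
    obtain rfl | rfl | hj2 : j = 0 ∨ j = 1 ∨ 2 ≤ j := by omega
    · simpa [z] using hq 0 (by omega)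
    · simpa [z, ← h2] using hq 1 (by omega)
    · obtain ⟨j, rfl⟩ := Nat.exists_eq_add_of_le' hj2
      have h : z (j + 2 + 1) = r (y (j + 1)) := by
        simp [z, show j + 2 + 1 - 2 = j + 1 by omega]
      have h' : z (j + 2) = r (y j) := by simp [z]
      rw [h, h', ← map_pow, ← hy j (by omega)]
      simp
  have hz0 : z (k + 4) = z 0 := by
    simp [z, h0, show k + 4 - 2 = k + 2 by omega]
  refine ⟨PushoutI φ, inferInstance, fun n => z (n % (k + 4)), ?_, ?_, ?_⟩
  · intro n
    have hlt := Nat.mod_lt n (show k + 4 > 0 by omega)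
    have h : z ((n + 1) % (k + 4)) = z (n % (k + 4) + 1) := by
      rw [Nat.add_mod, Nat.mod_eq_of_lt (show 1 < k + 4 by omega)]
      obtain h | h : n % (k + 4) + 1 < k + 4 ∨ n % (k + 4) + 1 = k + 4 := by omega
      · rw [Nat.mod_eq_of_lt h]
      · rw [h, Nat.mod_self, hz0]
    dsimp only
    rw [h]
    exact hz _ hlt
  · intro m n h
    exact congrArg z h
  · have hq : Injective q := (PushoutI.of_injective hφ true).comp (Prod.mk_left_injective 1)
    change ¬ IsOfFinOrder (z (0 % (k + 4)))
    rw [Nat.zero_mod]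
    change ¬ IsOfFinOrder (q (x 0))
    rw [hq.isOfFinOrder_iff, isOfFinOrder_iff_pow_eq_one]
    rintro ⟨n, hn, h⟩
    have := (zpowIndep_of_pairHom_injective hxi n 0 (by simpa using h)).1
    omega

theorem modEq_of_iterate_eq {α : Type*} {f : α → α} {a : α} {m n : ℕ}
    (ha : a ∈ periodicPts f) (h : f^[m] a = f^[n] a) : m ≡ n [MOD minimalPeriod f a] := by
  rw [← iterate_mod_minimalPeriod_eq, ← iterate_mod_minimalPeriod_eq (n := n)] at h
  have hp := minimalPeriod_pos_of_mem_periodicPts ha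
  exact (iterate_eq_iterate_iff_of_lt_minimalPeriod (Nat.mod_lt _ hp) (Nat.mod_lt _ hp)).mp h

/-- The indices at which an orbit meets itself are congruent modulo a suitable `p ≥ 4`. -/
theorem exists_orbit_modulus {f : ℕ+ → ℕ+} {i : ℕ+} (hi : ¬ EventuallyPeriodicPeriodLE3 f i) :
    ∃ p, 4 ≤ p ∧ ∀ m n, f^[m] i = f^[n] i → m ≡ n [MOD p] := by
  by_cases h : ∃ N, f^[N] i ∈ periodicPts f
  · obtain ⟨N, hN⟩ := h
    refine ⟨minimalPeriod f (f^[N] i), ?_, fun m n hmn => modEq_of_iterate_eq hN ?_⟩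
    · by_contra! hlt
      refine hi ⟨N, _, minimalPeriod_pos_of_mem_periodicPts hN, by omega, fun n hn => ?_⟩
      obtain ⟨d, rfl⟩ := Nat.exists_eq_add_of_le' hn
      rw [add_right_comm, iterate_add_apply, iterate_add_minimalPeriod_eq, ← iterate_add_apply]
    · rw [← iterate_add_apply, ← iterate_add_apply, add_comm m, add_comm n, iterate_add_apply,
        hmn, ← iterate_add_apply]
  · push Not at h
    have key (m d : ℕ) (hd : f^[d + m] i = f^[m] i) : d = 0 := by
      by_contra hd0
      exact h m (mk_mem_periodicPts (Nat.pos_of_ne_zero hd0)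
        (by rwa [iterate_add_apply] at hd))
    refine ⟨4, le_rfl, fun m n hmn => ?_⟩
    obtain hle | hle := le_total m n
    · obtain ⟨d, rfl⟩ := Nat.exists_eq_add_of_le' hle
      simp [key m d hmn.symm, Nat.ModEq.refl]
    · obtain ⟨d, rfl⟩ := Nat.exists_eq_add_of_le' hle
      simp [key n d hmn, Nat.ModEq.refl]

theorem presented_relation (f : ℕ+ → ℕ+) (j : ℕ+) :
    (PresentedGroup.of (rels := Prels f) (f j))⁻¹ * PresentedGroup.of j *
      PresentedGroup.of (f j) = PresentedGroup.of j ^ 2 :=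
  mul_inv_eq_one.mp (PresentedGroup.one_of_mem (rels := Prels f) ⟨j, rfl⟩)

theorem presented_of_eq_one {f : ℕ+ → ℕ+} {i : ℕ+} (hi : EventuallyPeriodicPeriodLE3 f i) :
    PresentedGroup.of (rels := Prels f) i = 1 := by
  obtain ⟨N, p, hp1, hp3, h⟩ := hi
  have hN : PresentedGroup.of (rels := Prels f) (f^[N] i) = 1 := by
    have hper := h N le_rfl
    rw [add_comm, iterate_add_apply] at hper
    set j := f^[N] i
    have r0 := presented_relation f j
    have r1 := presented_relation f (f j)
    have r2 := presented_relation f (f (f j))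
    interval_cases p <;> simp only [iterate_succ, iterate_zero, comp_apply, id] at hper
    · simp only [hper] at r0
      exact doubling_cycle_two r0 r0
    · rw [hper] at r1
      exact doubling_cycle_two r0 r1
    · rw [hper] at r2
      exact doubling_cycle_three r0 r1 r2
  clear h
  induction N with
  | zero => exact hN
  | succ N ih =>
    refine ih ?_
    have hr := presented_relation f (f^[N] i)
    rw [← iterate_succ_apply' f, hN] at hr
    simpa [pow_two] using hr

theorem presented_of_not_isOfFinOrder {f : ℕ+ → ℕ+} {i : ℕ+}
    (hi : ¬ EventuallyPeriodicPeriodLE3 f i) :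
    ¬ IsOfFinOrder (PresentedGroup.of (rels := Prels f) i) := by
  classical
  obtain ⟨p, hp, hmod⟩ := exists_orbit_modulus hi
  obtain ⟨P, _, w, hw, hwp, hw0⟩ := exists_doubling_cycle hp
  let c : ℕ+ → P := fun j => if h : ∃ n, f^[n] i = j then w h.choose else 1
  have hc (n : ℕ) : c (f^[n] i) = w n := by
    have h : ∃ m, f^[m] i = f^[n] i := ⟨n, rfl⟩
    exact (dif_pos h).trans (hwp _ _ (hmod _ _ h.choose_spec))
  have hrel : ∀ r ∈ Prels f, FreeGroup.lift c r = 1 := by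
    rintro _ ⟨j, rfl⟩
    simp only [map_mul, map_inv, map_pow, FreeGroup.lift_apply_of]
    rw [mul_inv_eq_one]
    by_cases h : ∃ n, f^[n] i = j
    · obtain ⟨n, rfl⟩ := h
      rw [← iterate_succ_apply' f, hc, hc, hw]
    · have hcj : c j = 1 := dif_neg h
      simp [hcj]
  intro hfin
  have h := (PresentedGroup.toGroup hrel).isOfFinOrder hfin
  rw [PresentedGroup.toGroup.of] at h
  exact hw0 (hc 0 ▸ h)

theorem stmt_1 (f : ℕ+ → ℕ+) (i : ℕ+) :
    (EventuallyPeriodicPeriodLE3 f i →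
      PresentedGroup.of (rels := Prels f) i = 1) ∧
    (¬ EventuallyPeriodicPeriodLE3 f i →
      ¬ IsOfFinOrder (PresentedGroup.of (rels := Prels f) i)) := by
  exact ⟨presented_of_eq_one, presented_of_not_isOfFinOrder⟩
end
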